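/- Let φ: ℙ¹ → ℙ¹ be an endomorphism of degree d ≥ 2 defined over F_2(t) with good reduction at every finite place. If P ∈ ℙ¹(F_2(t)) is preperiodic for φ, then the orbit of P has cardinality at most 9. -/

import Mathlib

set_option synthInstance.maxHeartbeats 1000000
noncomputable section

/-- The `v`-adic logarithmic distance between coordinate representatives of points of
`ℙ¹(K)`. -/
def logDist {K : Type} [Field K] (v : K → WithTop ℤ) (P Q : K × K) : WithTop ℤ :=
  v (P.1 * Q.2 - Q.1 * P.2) - min (v P.1) (v P.2) - min (v Q.1) (v Q.2)

/-- Evaluation at a point of the pair of binary forms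
`F(X,Y) = ∑ aᵢ Xⁱ Y^(d−i)`, `G(X,Y) = ∑ bᵢ Xⁱ Y^(d−i)` of degree `d`,
i.e. the map `φ([X:Y]) = [F(X,Y):G(X,Y)]` in homogeneous coordinates. -/
def evalPair {K : Type} [CommRing K] (d : ℕ) (a b : Fin (d+1) → K) (P : K × K) : K × K :=
  (∑ i : Fin (d+1), a i * P.1 ^ (i:ℕ) * P.2 ^ (d - (i:ℕ)),
   ∑ i : Fin (d+1), b i * P.1 ^ (i:ℕ) * P.2 ^ (d - (i:ℕ)))

/-- The Sylvester matrix of the two binary forms of degree `d` with coefficient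
vectors `a`, `b`. -/
def sylvester {K : Type} [CommRing K] (d : ℕ) (a b : Fin (d+1) → K) :
    Matrix (Fin (d+d)) (Fin (d+d)) K :=
  fun i j =>
    if _ : (i:ℕ) < d then
      if hj : (i:ℕ) ≤ (j:ℕ) ∧ (j:ℕ) ≤ (i:ℕ) + d then a ⟨(j:ℕ) - (i:ℕ), by omega⟩ else 0
    else
      if hj : (i:ℕ) - d ≤ (j:ℕ) ∧ (j:ℕ) ≤ (i:ℕ) then b ⟨(j:ℕ) - ((i:ℕ) - d), by omega⟩ else 0

/-- The (homogeneous) resultant `Res(F,G)` of the two binary forms of degree `d`,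
as the determinant of their Sylvester matrix. -/
def resultant {K : Type} [CommRing K] (d : ℕ) (a b : Fin (d+1) → K) : K :=
  (sylvester d a b).det

/-- The map `φ = [F:G]` has good reduction at the place `v`: after multiplying `F`
and `G` by a suitable nonzero scalar `u` (so as to be in `v`-reduced form: all
coefficients in the valuation ring of `v` and at least one of them a `v`-unit), the
resultant `Res(uF, uG)` is a `v`-unit. -/
def GoodReduction {K : Type} [Field K] (v : K → WithTop ℤ) (d : ℕ)
    (a b : Fin (d+1) → K) : Prop :=
  ∃ u : K, u ≠ 0 ∧ (∀ i, 0 ≤ v (u * a i) ∧ 0 ≤ v (u * b i)) ∧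
    ((∃ i, v (u * a i) = 0) ∨ (∃ i, v (u * b i) = 0)) ∧
    v (resultant d (fun i => u * a i) (fun i => u * b i)) = 0

open scoped Classical

/-- The valuation of `F_p(t)` attached to a monic irreducible polynomial `π` (a
finite place of `F_p(t)`). -/
def polyVal (p : ℕ) [Fact p.Prime] (π : Polynomial (ZMod p)) (f : RatFunc (ZMod p)) :
    WithTop ℤ :=
  if f = 0 then ⊤ else
    ((((UniqueFactorizationMonoid.normalizedFactors f.num).count π : ℤ) -
      ((UniqueFactorizationMonoid.normalizedFactors f.denom).count π : ℤ) : ℤ) : WithTop ℤ)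

open scoped Polynomial

section Forms

variable {A B : Type} [CommRing A] [CommRing B]

lemma evalPair_smul (d : ℕ) (a b : Fin (d+1) → A) (c : A) (P : A × A) :
    evalPair d a b (c • P) = c ^ d • evalPair d a b P := by
  have key : ∀ (f : Fin (d+1) → A) (i : Fin (d+1)),
      f i * (c * P.1) ^ (i:ℕ) * (c * P.2) ^ (d - (i:ℕ))
        = c ^ d * (f i * P.1 ^ (i:ℕ) * P.2 ^ (d - (i:ℕ))) := by
    intro f i
    have : c ^ d = c ^ (i:ℕ) * c ^ (d - (i:ℕ)) := by
      rw [← pow_add]; congr 1; omega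
    rw [this, mul_pow, mul_pow]; ring
  ext <;> simp [evalPair, key, Finset.mul_sum]

lemma evalPair_smul_coeff (d : ℕ) (a b : Fin (d+1) → A) (c : A) (P : A × A) :
    evalPair d (fun i => c * a i) (fun i => c * b i) P = c • evalPair d a b P := by
  ext <;> simp [evalPair, Finset.mul_sum, mul_assoc]

lemma evalPair_map (f : A →+* B) (d : ℕ) (a b : Fin (d+1) → A) (P : A × A) :
    evalPair d (fun i => f (a i)) (fun i => f (b i)) (P.map f f)
      = (evalPair d a b P).map f f := by
  ext <;> simp [evalPair]

lemma sylvester_smul (d : ℕ) (a b : Fin (d+1) → A) (c : A) :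
    sylvester d (fun i => c * a i) (fun i => c * b i) = c • sylvester d a b := by
  ext i j
  simp only [sylvester, Matrix.smul_apply, smul_eq_mul]
  split_ifs <;> simp

lemma resultant_smul (d : ℕ) (a b : Fin (d+1) → A) (c : A) :
    resultant d (fun i => c * a i) (fun i => c * b i) = c ^ (d + d) * resultant d a b := by
  simp [resultant, sylvester_smul]

lemma resultant_map (f : A →+* B) (d : ℕ) (a b : Fin (d+1) → A) :
    resultant d (fun i => f (a i)) (fun i => f (b i)) = f (resultant d a b) := by
  rw [resultant, resultant, RingHom.map_det]
  congr 1
  ext i j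
  simp only [sylvester, RingHom.mapMatrix_apply, Matrix.map_apply]
  split_ifs <;> simp

/-- A shifted coefficient vector paired with the monomials of degree `2 d - 1`. -/
lemma sum_shift_mul_monomial (d : ℕ) (a : Fin (d+1) → A) (x y : A) (s : ℕ) (hs : s < d) :
    ∑ j : Fin (d+d), (if hj : s ≤ (j:ℕ) ∧ (j:ℕ) ≤ s + d then a ⟨(j:ℕ) - s, by omega⟩ else 0)
        * (x ^ (j:ℕ) * y ^ (d + d - 1 - (j:ℕ)))
      = x ^ s * y ^ (d - 1 - s) * ∑ i : Fin (d+1), a i * x ^ (i:ℕ) * y ^ (d - (i:ℕ)) := by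
  rw [Finset.mul_sum]
  symm
  refine Finset.sum_of_injOn (fun i : Fin (d+1) => (⟨(i:ℕ) + s, by omega⟩ : Fin (d+d)))
    ?_ ?_ ?_ ?_
  · intro i _ j _ h
    simp only [Fin.mk.injEq] at h
    exact Fin.ext (by omega)
  · intro i _; simp
  · intro j _ hj
    rw [dif_neg, zero_mul]
    rintro ⟨h1, h2⟩
    exact hj ⟨⟨(j:ℕ) - s, by omega⟩, by simp, Fin.ext (by simp; omega)⟩
  · intro i _
    rw [dif_pos (by constructor <;> simp; omega)]
    have h1 : d + d - 1 - ((i:ℕ) + s) = (d - 1 - s) + (d - (i:ℕ)) := by omega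
    simp only [h1, Nat.add_sub_cancel, Fin.eta, pow_add]
    ring

lemma isCoprime_evalPair {d : ℕ} (hd : 0 < d) (a b : Fin (d+1) → A)
    (hr : IsUnit (resultant d a b)) (P : A × A) (hP : IsCoprime P.1 P.2) :
    IsCoprime (evalPair d a b P).1 (evalPair d a b P).2 := by
  obtain ⟨x, y⟩ := P
  set I : Ideal A := Ideal.span {(evalPair d a b (x, y)).1, (evalPair d a b (x, y)).2}
  let m : Fin (d+d) → A := fun j => x ^ (j:ℕ) * y ^ (d + d - 1 - (j:ℕ))
  have hmem : ∀ i, (sylvester d a b).mulVec m i ∈ I := by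
    intro i
    by_cases hi : (i:ℕ) < d
    · have := sum_shift_mul_monomial d a x y i hi
      have h2 : (sylvester d a b).mulVec m i
          = x ^ (i:ℕ) * y ^ (d - 1 - (i:ℕ)) * (evalPair d a b (x, y)).1 := by
        rw [evalPair, ← this]
        simp [Matrix.mulVec, dotProduct, sylvester, hi, m]
      rw [h2]
      exact I.mul_mem_left _ (Ideal.subset_span (by simp))
    · have := sum_shift_mul_monomial d b x y ((i:ℕ) - d) (by omega)
      have h2 : (sylvester d a b).mulVec m i
          = x ^ ((i:ℕ) - d) * y ^ (d - 1 - ((i:ℕ) - d)) * (evalPair d a b (x, y)).2 := by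
        rw [evalPair, ← this]
        have e : (i:ℕ) - d + d = i := by omega
        simp [Matrix.mulVec, dotProduct, sylvester, hi, m, e]
      rw [h2]
      exact I.mul_mem_left _ (Ideal.subset_span (by simp))
  have hm : ∀ j, m j ∈ I := by
    intro j
    have h1 : (sylvester d a b).adjugate.mulVec ((sylvester d a b).mulVec m) j
        = resultant d a b * m j := by
      rw [Matrix.mulVec_mulVec, Matrix.adjugate_mul, Matrix.smul_mulVec, Matrix.one_mulVec]
      rfl
    have h2 : resultant d a b * m j ∈ I := by
      rw [← h1]
      exact Ideal.sum_mem I (t := Finset.univ) (f := fun i => (sylvester d a b).adjugate j i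
        * (sylvester d a b).mulVec m i) fun i _ => I.mul_mem_left _ (hmem i)
    exact (I.unit_mul_mem_iff_mem hr).1 h2
  have hx : x ^ (d + d - 1) ∈ I := by
    simpa [m] using hm ⟨d + d - 1, by omega⟩
  have hy : y ^ (d + d - 1) ∈ I := by
    simpa [m] using hm ⟨0, by omega⟩
  have hc : IsCoprime (x ^ (d + d - 1)) (y ^ (d + d - 1)) := IsCoprime.pow hP
  obtain ⟨r, s, hrs⟩ := hc
  have h1 : (1 : A) ∈ I := by
    rw [← hrs]
    exact I.add_mem (I.mul_mem_left _ hx) (I.mul_mem_left _ hy)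
  exact Ideal.mem_span_pair.1 h1

/-- The determinant of two coordinate vectors. -/
def wedge (P Q : A × A) : A := P.1 * Q.2 - Q.1 * P.2

lemma wedge_swap (P Q : A × A) : wedge P Q = - wedge Q P := by
  simp only [wedge]; ring

lemma dvd_wedge_trans {c : A} {P Q S : A × A} (hQ : IsCoprime Q.1 Q.2)
    (h1 : c ∣ wedge P Q) (h2 : c ∣ wedge Q S) : c ∣ wedge P S := by
  obtain ⟨r, s, hrs⟩ := hQ
  have : wedge P S = wedge P Q * (r * S.1 + s * S.2) + wedge Q S * (r * P.1 + s * P.2) := by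
    simp only [wedge]
    linear_combination (-(P.1 * S.2 - S.1 * P.2)) * hrs
  rw [this]
  exact dvd_add (h1.mul_right _) (h2.mul_right _)

lemma exists_smul_of_wedge_eq_zero {P Q : A × A} (hP : IsCoprime P.1 P.2)
    (h : wedge P Q = 0) : ∃ c : A, Q = c • P := by
  obtain ⟨r, s, hrs⟩ := hP
  simp only [wedge] at h
  refine ⟨r * Q.1 + s * Q.2, Prod.ext ?_ ?_⟩
  · simp only [Prod.smul_fst, smul_eq_mul]
    linear_combination (-Q.1) * hrs - s * h
  · simp only [Prod.smul_snd, smul_eq_mul]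
    linear_combination (-Q.2) * hrs + r * h

lemma map_wedge_evalPair_eq_zero (f : A →+* B) (d : ℕ) (a b : Fin (d+1) → A) {P Q : A × A}
    (hP : IsCoprime P.1 P.2) (h : f (wedge P Q) = 0) :
    f (wedge (evalPair d a b P) (evalPair d a b Q)) = 0 := by
  have hf : ∀ S T : A × A, f (wedge S T) = wedge (S.map f f) (T.map f f) := by
    intro S T; simp [wedge]
  rw [hf] at h
  obtain ⟨c, hc⟩ := exists_smul_of_wedge_eq_zero (P := P.map f f) (hP.map f) h
  rw [hf, ← evalPair_map, ← evalPair_map, hc, evalPair_smul]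
  simp only [wedge, Prod.smul_fst, Prod.smul_snd, smul_eq_mul]
  ring

lemma wedge_dvd_wedge_evalPair (d : ℕ) (a b : Fin (d+1) → A) {P Q : A × A}
    (hP : IsCoprime P.1 P.2) :
    wedge P Q ∣ wedge (evalPair d a b P) (evalPair d a b Q) := by
  rw [← Ideal.mem_span_singleton, ← Ideal.Quotient.eq_zero_iff_mem]
  refine map_wedge_evalPair_eq_zero _ d a b hP ?_
  exact Ideal.Quotient.eq_zero_iff_mem.2 (Ideal.mem_span_singleton_self _)

end Forms

section Orbits

open Polynomial

lemma eq_one_of_isUnit {c : (ZMod 2)[X]} (h : IsUnit c) : c = 1 := by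
  obtain ⟨r, hr, rfl⟩ := Polynomial.isUnit_iff.1 h
  have : ∀ r : ZMod 2, r ≠ 0 → r = 1 := by decide
  rw [this r hr.ne_zero, map_one]

lemma eq_of_dvd_of_dvd {x y : (ZMod 2)[X]} (h1 : x ∣ y) (h2 : y ∣ x) : x = y := by
  obtain ⟨u, hu⟩ := associated_of_dvd_dvd h1 h2
  rw [eq_one_of_isUnit u.isUnit, mul_one] at hu
  exact hu

lemma eq_of_wedge_eq_zero {P Q : (ZMod 2)[X] × (ZMod 2)[X]} (hP : IsCoprime P.1 P.2)
    (hQ : IsCoprime Q.1 Q.2) (h : wedge P Q = 0) : P = Q := by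
  obtain ⟨c, rfl⟩ := exists_smul_of_wedge_eq_zero hP h
  have hc : IsUnit c := hQ.isUnit_of_dvd' ⟨P.1, rfl⟩ ⟨P.2, rfl⟩
  rw [eq_one_of_isUnit hc, one_smul]

lemma eq_zero_or_one_of_recurrence {t : ℕ → (ZMod 2)[X]} {n : ℕ} (hn : 0 < n)
    (ht : Function.Periodic t n) {u : (ZMod 2)[X]}
    (hu : ∀ k, t (k + 2) + t k = u * t (k + 1)) {j : ℕ} (hj : t j ≠ 0) : u = 0 ∨ u = 1 := by
  obtain ⟨i, -, hi⟩ := Finset.exists_max_image (Finset.range n) (fun i => (t i).degree)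
    ⟨0, by simpa using hn⟩
  have hmax : ∀ k, (t k).degree ≤ (t i).degree := by
    intro k
    rw [← ht.map_mod_nat k]
    exact hi _ (by simpa using Nat.mod_lt _ hn)
  have hi0 : t i ≠ 0 := by
    intro h
    have := hmax j
    rw [h, degree_zero, le_bot_iff, degree_eq_bot] at this
    exact hj this
  have hrec := hu (i + n - 1)
  rw [show i + n - 1 + 1 = i + n by omega, ht i] at hrec
  have hdeg : (u * t i).degree ≤ (t i).degree := by
    rw [← hrec]
    exact (degree_add_le _ _).trans (max_le (hmax _) (hmax _))
  have hu0 : u.natDegree = 0 := by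
    by_cases h0 : u = 0
    · simp [h0]
    have := natDegree_le_natDegree hdeg
    rw [natDegree_mul h0 hi0] at this
    omega
  obtain ⟨c, rfl⟩ := natDegree_eq_zero.1 hu0
  have : ∀ c : ZMod 2, c = 0 ∨ c = 1 := by decide
  rcases this c with rfl | rfl <;> simp

variable {p : ℕ → (ZMod 2)[X] × (ZMod 2)[X]}

lemma dvd_wedge_add (hdvd : ∀ i j, wedge (p i) (p j) ∣ wedge (p (i+1)) (p (j+1)))
    (i j k : ℕ) : wedge (p i) (p j) ∣ wedge (p (i+k)) (p (j+k)) := by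
  induction k with
  | zero => simp
  | succ k ih => exact ih.trans (hdvd _ _)

/-- A cycle in characteristic two has length at most three. -/
lemma exists_period_le_three (hcop : ∀ i, IsCoprime (p i).1 (p i).2)
    (hdvd : ∀ i j, wedge (p i) (p j) ∣ wedge (p (i+1)) (p (j+1)))
    {n : ℕ} (hn : 0 < n) (hper : Function.Periodic p n) :
    ∃ e, 0 < e ∧ e ≤ 3 ∧ p e = p 0 := by
  have hconst : ∀ k l, wedge (p k) (p (k+l)) = wedge (p 0) (p l) := by
    intro k l
    apply eq_of_dvd_of_dvd
    · have h := dvd_wedge_add hdvd k (k+l) (k * n - k)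
      have hk : k ≤ k * n := Nat.le_mul_of_pos_right _ hn
      rw [show k + (k * n - k) = 0 + k * n by omega,
        show k + l + (k * n - k) = l + k * n by omega] at h
      have hk' := hper.nat_mul k
      simp only [Nat.cast_id] at hk'
      rwa [hk' 0, hk' l] at h
    · have h := dvd_wedge_add hdvd 0 l k
      rwa [zero_add, add_comm l] at h
  by_cases h1 : wedge (p 0) (p 1) = 0
  · exact ⟨1, by omega, by omega, (eq_of_wedge_eq_zero (hcop _) (hcop _) h1).symm⟩
  obtain ⟨u, hu⟩ : wedge (p 0) (p 1) ∣ wedge (p 0) (p 2) :=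
    dvd_wedge_trans (hcop 1) dvd_rfl (hdvd 0 1)
  have hrec : ∀ k, p (k+2) + p k = u • p (k+1) := by
    intro k
    have e1 := hconst k 1
    have e2 := hconst (k+1) 1
    have e3 := hconst k 2
    rw [hu] at e3
    simp only [wedge] at e1 e2 e3
    rw [add_assoc] at e2
    set D := wedge (p 0) (p 1) with hD
    simp only [wedge] at hD
    rw [← hD] at e1 e2 e3
    norm_num at e2
    refine Prod.ext (mul_left_cancel₀ h1 ?_) (mul_left_cancel₀ h1 ?_)
    · simp only [Prod.fst_add, Prod.smul_fst, smul_eq_mul]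
      linear_combination (-(p (k+2)).1) * e1 - (p k).1 * e2 + (p (k+1)).1 * e3
    · simp only [Prod.snd_add, Prod.smul_snd, smul_eq_mul]
      linear_combination (-(p (k+2)).2) * e1 - (p k).2 * e2 + (p (k+1)).2 * e3
  have hu01 : u = 0 ∨ u = 1 := by
    rcases (hcop 0).ne_zero_or_ne_zero with h | h
    · exact eq_zero_or_one_of_recurrence (t := fun k => (p k).1) hn
        (fun k => congrArg Prod.fst (hper k)) (fun k => congrArg Prod.fst (hrec k)) h
    · exact eq_zero_or_one_of_recurrence (t := fun k => (p k).2) hn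
        (fun k => congrArg Prod.snd (hper k)) (fun k => congrArg Prod.snd (hrec k)) h
  have r0 := hrec 0
  have r1 := hrec 1
  rcases hu01 with rfl | rfl
  · rw [zero_smul] at r0
    exact ⟨2, by omega, by omega, by
      ext1 <;> [have := congrArg Prod.fst r0; have := congrArg Prod.snd r0] <;>
      exact CharTwo.add_eq_zero.1 this⟩
  · rw [one_smul] at r0 r1
    refine ⟨3, by omega, by omega, ?_⟩
    norm_num at r0 r1
    have hch : (2 : (ZMod 2)[X]) = 0 := CharTwo.two_eq_zero
    ext1
    · have a0 := congrArg Prod.fst r0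
      have a1 := congrArg Prod.fst r1
      simp only [Prod.fst_add] at a0 a1
      linear_combination a1 + a0 - (p 0).1 * hch
    · have a0 := congrArg Prod.snd r0
      have a1 := congrArg Prod.snd r1
      simp only [Prod.snd_add] at a0 a1
      linear_combination a1 + a0 - (p 0).2 * hch

/-- A tail ending in a fixed point has at most two points. -/
lemma eq_of_tail (hcop : ∀ i, IsCoprime (p i).1 (p i).2)
    (hdvd : ∀ i j, wedge (p i) (p j) ∣ wedge (p (i+1)) (p (j+1)))
    (hfix : p 4 = p 3) : p 2 = p 3 := by
  by_contra hne
  have h01 := hdvd 0 1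
  have h12 := hdvd 1 2
  have h02 := hdvd 0 2
  have hf0 := hdvd 0 3
  have hf1 := hdvd 1 3
  norm_num at h01 h12 h02 hf0 hf1
  rw [hfix] at hf0 hf1
  have sw : ∀ {c : (ZMod 2)[X]} {i j : ℕ}, c ∣ wedge (p i) (p j) → c ∣ wedge (p j) (p i) := by
    intro c i j h
    rw [wedge_swap]
    exact (dvd_neg).2 h
  have e01 : wedge (p 0) (p 1) = wedge (p 0) (p 3) :=
    eq_of_dvd_of_dvd
      (dvd_wedge_trans (hcop 1) dvd_rfl
        (dvd_wedge_trans (hcop 2) h01 (h01.trans h12)))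
      (dvd_wedge_trans (hcop 3) dvd_rfl (sw hf0))
  have e12 : wedge (p 1) (p 2) = wedge (p 1) (p 3) :=
    eq_of_dvd_of_dvd (dvd_wedge_trans (hcop 2) dvd_rfl h12)
      (dvd_wedge_trans (hcop 3) dvd_rfl (sw hf1))
  have e02 : wedge (p 0) (p 2) = wedge (p 0) (p 3) :=
    eq_of_dvd_of_dvd (dvd_wedge_trans (hcop 2) dvd_rfl (h02.trans hf1))
      (dvd_wedge_trans (hcop 3) dvd_rfl (sw (hf0.trans hf1)))
  have hpl : wedge (p 0) (p 1) * wedge (p 2) (p 3) - wedge (p 0) (p 2) * wedge (p 1) (p 3)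
      + wedge (p 0) (p 3) * wedge (p 1) (p 2) = 0 := by
    simp only [wedge]; ring
  rw [e01, e02, e12, sub_add_cancel] at hpl
  have h23 : wedge (p 2) (p 3) = 0 := by
    rcases mul_eq_zero.1 hpl with h | h
    · rw [h] at hf0
      exact zero_dvd_iff.1 ((zero_dvd_iff.1 hf0) ▸ hf1)
    · exact h
  exact hne (eq_of_wedge_eq_zero (hcop _) (hcop _) h23)

lemma eventually_periodic_propagates_down (hcop : ∀ i, IsCoprime (p i).1 (p i).2)
    (hdvd : ∀ i j, wedge (p i) (p j) ∣ wedge (p (i+1)) (p (j+1)))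
    {e M : ℕ} (h : ∀ k, M ≤ k → p (k + e) = p k) (k : ℕ) (hk : 2 * e ≤ k) :
    p (k + e) = p k := by
  by_contra hne
  have key : ∀ j k, 2 * e ≤ k → p (k + e) ≠ p k → p (k + j * e + e) ≠ p (k + j * e) := by
    intro j
    induction j with
    | zero => intro k _ h; simpa using h
    | succ j ih =>
      intro k hk h
      have h1 := ih k hk h
      intro h2
      apply h1
      set c := k + j * e - 2 * e with hc
      have hkj : k + j * e = c + 2 * e := by omega
      have := eq_of_tail (p := fun i => p (c + i * e)) (fun i => hcop _) (fun i j => by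
        have := dvd_wedge_add hdvd (c + i * e) (c + j * e) e
        convert this using 3 <;> ring_nf) (by
          have : k + (j + 1) * e = c + 3 * e := by linarith
          rw [this] at h2
          convert h2 using 2; ring)
      rw [hkj]
      convert this.symm using 2; ring
  rcases Nat.eq_zero_or_pos e with rfl | he
  · simp at hne
  exact key M k hk hne (h _ (by nlinarith))

/-- An eventually periodic orbit has at most nine points. -/
lemma exists_image_range_nine (hcop : ∀ i, IsCoprime (p i).1 (p i).2)
    (hdvd : ∀ i j, wedge (p i) (p j) ∣ wedge (p (i+1)) (p (j+1)))
    (hstep : ∀ i j, p i = p j → p (i+1) = p (j+1))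
    {m n : ℕ} (hn : 0 < n) (hmn : p (m + n) = p m) :
    ∀ k, ∃ i < 9, p k = p i := by
  have hadd : ∀ k i j, p i = p j → p (i+k) = p (j+k) := by
    intro k
    induction k with
    | zero => intro i j h; exact h
    | succ k ih => intro i j h; exact hstep _ _ (ih i j h)
  obtain ⟨e, he, he3, hee⟩ := exists_period_le_three (p := fun k => p (m + k))
    (fun i => hcop _) (fun i j => hdvd _ _) hn (fun k => by
      have := hadd k _ _ hmn
      convert this using 2; ring)
  have hM : ∀ k, m ≤ k → p (k + e) = p k := by
    intro k hk
    have := hadd (k - m) _ _ hee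
    convert this using 2 <;> omega
  intro k
  induction k using Nat.strong_induction_on with
  | _ k ih =>
    by_cases hk : k < 9
    · exact ⟨k, hk, rfl⟩
    · obtain ⟨i, hi, h⟩ := ih (k - e) (by omega)
      refine ⟨i, hi, ?_⟩
      rw [← h, ← eventually_periodic_propagates_down hcop hdvd hM (k - e) (by omega)]
      congr 1; omega

end Orbits

section Valuation

variable {p : ℕ} [Fact p.Prime] {π : (ZMod p)[X]}

lemma polyVal_zero : polyVal p π 0 = ⊤ := by simp [polyVal]

lemma polyVal_div {f g : (ZMod p)[X]} (hf : f ≠ 0) (hg : g ≠ 0) :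
    polyVal p π (algebraMap _ _ f / algebraMap _ _ g) =
      (((UniqueFactorizationMonoid.normalizedFactors f).count π : ℤ) -
      ((UniqueFactorizationMonoid.normalizedFactors g).count π : ℤ) : ℤ) := by
  set x : RatFunc (ZMod p) := algebraMap _ _ f / algebraMap _ _ g with hx
  have hx0 : x ≠ 0 := div_ne_zero (RatFunc.algebraMap_ne_zero hf) (RatFunc.algebraMap_ne_zero hg)
  rw [polyVal, if_neg hx0]
  have h : x.num * g = f * x.denom := (RatFunc.num_mul_eq_mul_denom_iff hg).2 hx
  have h2 := congrArg (fun q => (UniqueFactorizationMonoid.normalizedFactors q).count π) h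
  simp only [UniqueFactorizationMonoid.normalizedFactors_mul (RatFunc.num_ne_zero hx0) hg,
    UniqueFactorizationMonoid.normalizedFactors_mul hf x.denom_ne_zero, Multiset.count_add] at h2
  rw [WithTop.coe_inj]
  omega

lemma polyVal_mul (x y : RatFunc (ZMod p)) :
    polyVal p π (x * y) = polyVal p π x + polyVal p π y := by
  by_cases hx : x = 0
  · simp [hx, polyVal_zero]
  by_cases hy : y = 0
  · simp [hy, polyVal_zero]
  have hxn := RatFunc.num_ne_zero hx
  have hyn := RatFunc.num_ne_zero hy
  have h : x * y = algebraMap (ZMod p)[X] _ (x.num * y.num)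
      / algebraMap _ _ (x.denom * y.denom) := by
    rw [map_mul, map_mul, mul_div_mul_comm, RatFunc.num_div_denom, RatFunc.num_div_denom]
  rw [h, polyVal_div (mul_ne_zero hxn hyn) (mul_ne_zero x.denom_ne_zero y.denom_ne_zero),
    UniqueFactorizationMonoid.normalizedFactors_mul hxn hyn,
    UniqueFactorizationMonoid.normalizedFactors_mul x.denom_ne_zero y.denom_ne_zero,
    polyVal, polyVal, if_neg hx, if_neg hy, Multiset.count_add, Multiset.count_add]
  rw [← WithTop.coe_add, WithTop.coe_inj]
  push_cast
  ring

lemma polyVal_algebraMap {f : (ZMod p)[X]} (hf : f ≠ 0) :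
    polyVal p π (algebraMap _ _ f) =
      (((UniqueFactorizationMonoid.normalizedFactors f).count π : ℤ) : WithTop ℤ) := by
  have := polyVal_div (π := π) hf one_ne_zero
  simpa using this

lemma polyVal_algebraMap_nonneg (f : (ZMod p)[X]) : 0 ≤ polyVal p π (algebraMap _ _ f) := by
  by_cases hf : f = 0
  · simp [hf, polyVal_zero]
  · rw [polyVal_algebraMap hf]
    exact_mod_cast Int.natCast_nonneg _

lemma polyVal_algebraMap_eq_zero_iff (hm : π.Monic) (hi : Irreducible π) (f : (ZMod p)[X]) :
    polyVal p π (algebraMap _ _ f) = 0 ↔ ¬ π ∣ f := by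
  by_cases hf : f = 0
  · simp [hf, polyVal_zero]
  · rw [polyVal_algebraMap hf]
    norm_cast
    rw [Multiset.count_eq_zero, UniqueFactorizationMonoid.mem_normalizedFactors_iff' hf]
    simp [hi, hm.normalize_eq_self]

lemma polyVal_pow_eq_zero {x : RatFunc (ZMod p)} (hx : polyVal p π x = 0) (k : ℕ) :
    polyVal p π (x ^ k) = 0 := by
  have h1 : polyVal p π 1 = 0 := by
    have := polyVal_algebraMap (π := π) (one_ne_zero (α := (ZMod p)[X]))
    simpa using this
  induction k with
  | zero => simpa using h1
  | succ k ih => rw [pow_succ, polyVal_mul, ih, hx, add_zero]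

end Valuation

/-- Clearing denominators and common factors of a finite family of rational functions. -/
lemma exists_primitive_multiple {F ι : Type} [Field F] [Fintype ι] (f : ι → RatFunc F)
    {i₀ : ι} (hf : f i₀ ≠ 0) :
    ∃ u : RatFunc F, u ≠ 0 ∧ ∃ g : ι → F[X], (∀ i, u * f i = algebraMap _ _ (g i)) ∧
      ∀ q : F[X], (∀ i, q ∣ g i) → IsUnit q := by
  classical
  obtain ⟨b, hb⟩ := IsLocalization.exist_integer_multiples (nonZeroDivisors F[X])
    Finset.univ f
  choose! h hh using fun i => hb i (Finset.mem_univ i)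
  have hb0 : algebraMap F[X] (RatFunc F) b ≠ 0 :=
    RatFunc.algebraMap_ne_zero (nonZeroDivisors.coe_ne_zero b)
  have hh' : ∀ i, algebraMap F[X] (RatFunc F) (h i) = algebraMap F[X] (RatFunc F) b * f i := by
    intro i; rw [hh i, Algebra.smul_def]
  obtain ⟨g, hg, hg1⟩ := Finset.extract_gcd h (s := Finset.univ) ⟨i₀, Finset.mem_univ _⟩
  set c := Finset.univ.gcd h
  have hc : algebraMap F[X] (RatFunc F) c ≠ 0 := by
    intro hc0
    have h1 := hh' i₀
    rw [hg i₀ (Finset.mem_univ _), map_mul, hc0, zero_mul] at h1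
    exact mul_ne_zero hb0 hf h1.symm
  refine ⟨algebraMap F[X] (RatFunc F) b / algebraMap F[X] (RatFunc F) c,
    div_ne_zero hb0 hc, g, fun i => ?_, fun q hq => ?_⟩
  · rw [div_mul_eq_mul_div, ← hh' i, hg i (Finset.mem_univ _), map_mul,
      mul_div_cancel_left₀ _ hc]
  · exact isUnit_of_dvd_one (hg1 ▸ Finset.dvd_gcd fun i _ => hq i)

/-- A pair of forms with good reduction at every finite place is proportional to a pair of
forms over the polynomial ring whose resultant is a unit. -/
lemma exists_integral_model (p d : ℕ) [Fact p.Prime] (a b : Fin (d+1) → RatFunc (ZMod p))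
    (hgood : ∀ π : (ZMod p)[X], π.Monic → Irreducible π → GoodReduction (polyVal p π) d a b) :
    ∃ u : RatFunc (ZMod p), u ≠ 0 ∧ ∃ A B : Fin (d+1) → (ZMod p)[X],
      (∀ i, u * a i = algebraMap _ _ (A i)) ∧ (∀ i, u * b i = algebraMap _ _ (B i)) ∧
      IsUnit (resultant d A B) := by
  let f : Fin (d+1) ⊕ Fin (d+1) → RatFunc (ZMod p) := Sum.elim a b
  have hred : ∀ π : (ZMod p)[X], π.Monic → Irreducible π →
      ∃ w : RatFunc (ZMod p), w ≠ 0 ∧ (∀ i, 0 ≤ polyVal p π (w * f i)) ∧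
        (∃ i, polyVal p π (w * f i) = 0) ∧
        polyVal p π (resultant d (fun i => w * a i) (fun i => w * b i)) = 0 := by
    intro π hm hi
    obtain ⟨w, hw, h1, h2, h3⟩ := hgood π hm hi
    refine ⟨w, hw, ?_, ?_, h3⟩
    · rintro (i | i)
      exacts [(h1 i).1, (h1 i).2]
    · rcases h2 with ⟨i, h⟩ | ⟨i, h⟩
      exacts [⟨Sum.inl i, h⟩, ⟨Sum.inr i, h⟩]
  obtain ⟨i₀, hi₀⟩ : ∃ i, f i ≠ 0 := by
    obtain ⟨w, -, -, ⟨i, hi⟩, -⟩ := hred Polynomial.X Polynomial.monic_X Polynomial.irreducible_X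
    refine ⟨i, fun h => ?_⟩
    rw [h, mul_zero, polyVal_zero] at hi
    exact absurd hi (by simp)
  obtain ⟨u, hu, g, hg, hprim⟩ := exists_primitive_multiple f hi₀
  refine ⟨u, hu, fun i => g (Sum.inl i), fun i => g (Sum.inr i),
    fun i => hg (Sum.inl i), fun i => hg (Sum.inr i), ?_⟩
  set r := resultant d (fun i => g (Sum.inl i)) (fun i => g (Sum.inr i)) with hr
  have hres : algebraMap (ZMod p)[X] (RatFunc (ZMod p)) r
      = resultant d (fun i => u * a i) (fun i => u * b i) := by
    rw [hr, ← resultant_map]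
    congr 1 <;> ext1 i
    exacts [(hg (Sum.inl i)).symm, (hg (Sum.inr i)).symm]
  have hndvd : ∀ π : (ZMod p)[X], π.Monic → Irreducible π → ¬ π ∣ r := by
    intro π hm hi
    rw [← polyVal_algebraMap_eq_zero_iff hm hi, hres]
    obtain ⟨w, hw, h1, ⟨i, h2⟩, h3⟩ := hred π hm hi
    obtain ⟨j, hj⟩ : ∃ j, ¬ π ∣ g j := by
      by_contra! h
      exact hi.not_isUnit (hprim π h)
    have hsplit : ∀ x, u * x = (u / w) * (w * x) := by
      intro x; field_simp
    have hval : polyVal p π (u / w) = 0 := by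
      have k1 : polyVal p π (u * f i) = polyVal p π (u / w) := by
        rw [hsplit, polyVal_mul, h2, add_zero]
      have k2 : 0 ≤ polyVal p π (u / w) := by
        rw [← k1, hg]; exact polyVal_algebraMap_nonneg _
      have k3 : polyVal p π (u / w) + polyVal p π (w * f j) = 0 := by
        rw [← polyVal_mul, ← hsplit, hg, polyVal_algebraMap_eq_zero_iff hm hi]
        exact hj
      refine le_antisymm ?_ k2
      rw [← k3]
      exact le_add_of_nonneg_right (h1 j)
    have : resultant d (fun i => u * a i) (fun i => u * b i) = (u / w) ^ (d + d)
        * resultant d (fun i => w * a i) (fun i => w * b i) := by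
      rw [← resultant_smul]
      congr 1 <;> ext1 i <;> exact hsplit _
    rw [this, polyVal_mul, h3, polyVal_pow_eq_zero hval, add_zero]
  by_contra hru
  obtain ⟨q, hq, hqr⟩ := Polynomial.exists_monic_irreducible_factor r hru
  exact hndvd q hq hqr.1 hqr.2

lemma iterate_evalPair_eq_smul {R K : Type} [CommRing R] [Field K] (φ : R →+* K) (d : ℕ)
    (a b : Fin (d+1) → K) (A B : Fin (d+1) → R) {u : K} (hu : u ≠ 0)
    (hA : ∀ i, u * a i = φ (A i)) (hB : ∀ i, u * b i = φ (B i))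
    {P : K × K} {P' : R × R} {c : K} (hc : c ≠ 0) (hP : P = c • P'.map φ φ) (k : ℕ) :
    ∃ c : K, c ≠ 0 ∧ (evalPair d a b)^[k] P = c • ((evalPair d A B)^[k] P').map φ φ := by
  induction k with
  | zero => exact ⟨c, hc, hP⟩
  | succ k ih =>
    obtain ⟨c, hc, h⟩ := ih
    refine ⟨c ^ d * u⁻¹, mul_ne_zero (pow_ne_zero _ hc) (inv_ne_zero hu), ?_⟩
    rw [Function.iterate_succ_apply', Function.iterate_succ_apply', h, evalPair_smul,
      ← evalPair_map, ← funext hA, ← funext hB, evalPair_smul_coeff, smul_smul,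
      mul_assoc, inv_mul_cancel₀ hu, mul_one]

/-- Let `φ = [F:G]` be an endomorphism of `ℙ¹` of degree `d ≥ 2` defined over
`F_2(t)` with good reduction at every finite place.  If `P ∈ ℙ¹(F_2(t))` is
preperiodic for `φ`, then its forward orbit `O_φ(P) = {φ^n(P) : n ∈ ℕ}` (a set of
points of `ℙ¹`, i.e. of projective classes) has cardinality at most `9`. -/
theorem orbit_card_le_nine_char_two (d : ℕ) (hd : 2 ≤ d)
    (a b : Fin (d+1) → RatFunc (ZMod 2))
    (hgood : ∀ π : Polynomial (ZMod 2), π.Monic → Irreducible π →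
      GoodReduction (polyVal 2 π) d a b)
    (P : RatFunc (ZMod 2) × RatFunc (ZMod 2)) (hP : P ≠ (0, 0))
    (hpre : ∃ m n : ℕ, 0 < n ∧ ∃ c : RatFunc (ZMod 2), c ≠ 0 ∧
      (evalPair d a b)^[m + n] P = c • (evalPair d a b)^[m] P) :
    ∃ T : Finset (RatFunc (ZMod 2) × RatFunc (ZMod 2)), T.card ≤ 9 ∧
      ∀ k : ℕ, ∃ Q ∈ T, ∃ c : RatFunc (ZMod 2), c ≠ 0 ∧
        (evalPair d a b)^[k] P = c • Q := by
  obtain ⟨u, hu, A, B, hA, hB, hres⟩ := exists_integral_model 2 d a b hgood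
  set φ := algebraMap (ZMod 2)[X] (RatFunc (ZMod 2))
  have hinj : Function.Injective φ := RatFunc.algebraMap_injective _
  obtain ⟨P', c, hc, hcop, hPP⟩ : ∃ (P' : (ZMod 2)[X] × (ZMod 2)[X]) (c : RatFunc (ZMod 2)),
      c ≠ 0 ∧ IsCoprime P'.1 P'.2 ∧ P = c • P'.map φ φ := by
    obtain ⟨i₀, hi₀⟩ : ∃ i, ![P.1, P.2] i ≠ 0 := by
      by_contra! h
      exact hP (Prod.ext (h 0) (h 1))
    obtain ⟨w, hw, g, hg, hprim⟩ := exists_primitive_multiple ![P.1, P.2] hi₀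
    refine ⟨(g 0, g 1), w⁻¹, inv_ne_zero hw, ?_, ?_⟩
    · refine isCoprime_of_dvd _ _ ?_ ?_
      · rintro ⟨h0, h1⟩
        refine not_isUnit_zero (hprim 0 fun i => ?_)
        fin_cases i
        · exact zero_dvd_iff.2 h0
        · exact zero_dvd_iff.2 h1
      · intro z hz _ h0 h1
        refine hz (hprim z fun i => ?_)
        fin_cases i
        · exact h0
        · exact h1
    · have h0 : w * P.1 = φ (g 0) := hg 0
      have h1 : w * P.2 = φ (g 1) := hg 1
      ext1
      · simp [← h0, hw]
      · simp [← h1, hw]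
  have hiter := iterate_evalPair_eq_smul φ d a b A B hu hA hB hc hPP
  set p : ℕ → (ZMod 2)[X] × (ZMod 2)[X] := fun k => (evalPair d A B)^[k] P' with hp
  have hsucc : ∀ k, p (k+1) = evalPair d A B (p k) :=
    fun k => Function.iterate_succ_apply' _ _ _
  have hpcop : ∀ i, IsCoprime (p i).1 (p i).2 := by
    intro i
    induction i with
    | zero => exact hcop
    | succ i ih => rw [hsucc]; exact isCoprime_evalPair (by omega) A B hres _ ih
  obtain ⟨m, n, hn, c', hc', hmn⟩ := hpre
  have hmn' : p (m + n) = p m := by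
    obtain ⟨c₁, hc₁, h₁⟩ := hiter (m + n)
    obtain ⟨c₂, hc₂, h₂⟩ := hiter m
    rw [h₁, h₂] at hmn
    refine eq_of_wedge_eq_zero (hpcop _) (hpcop _) (hinj ?_)
    have f1 := congrArg Prod.fst hmn
    have f2 := congrArg Prod.snd hmn
    simp only [Prod.smul_fst, Prod.smul_snd, Prod.map_fst, Prod.map_snd, smul_eq_mul] at f1 f2
    rw [map_zero, wedge, map_sub, map_mul, map_mul]
    refine mul_left_cancel₀ hc₁ ?_
    linear_combination (φ (p m).2) * f1 - (φ (p m).1) * f2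
  have hnine := exists_image_range_nine hpcop
    (fun i j => by
      rw [hsucc, hsucc]
      exact wedge_dvd_wedge_evalPair d A B (hpcop i))
    (fun i j h => by rw [hsucc, hsucc, h]) hn hmn'
  refine ⟨(Finset.range 9).image fun i => (p i).map φ φ,
    Finset.card_image_le.trans (by simp), fun k => ?_⟩
  obtain ⟨i, hi, h⟩ := hnine k
  obtain ⟨c₁, hc₁, h₁⟩ := hiter k
  refine ⟨(p i).map φ φ, Finset.mem_image_of_mem _ (by simpa using hi), c₁, hc₁, ?_⟩
  rw [h₁, ← h]
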